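/- Let α>0 and a₀,a₁,x ∈ ℝ with a₁≠0, and let y ∈ C_α. For f ∈ C: if f(t) = x + ∫₀ᵗ φ(s)ds for some φ ∈ L²[0,1], then Λ*_{kʸ}(f−m) = (1/2)∫₀¹ ((φ(t) − a₀ − a₁f(t))/y(t))² dt; otherwise (if f(0) ≠ x or f is not absolutely continuous with derivative in L²[0,1]), Λ*_{kʸ}(f−m) = +∞. In other words, the Gaussian-process rate function Λ*_{kʸ}(f−m) coincides with the Freidlin–Wentzell rate function J(f|y). -/

import Mathlib

open MeasureTheory ProbabilityTheory Filter Topology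
open scoped ENNReal NNReal

noncomputable section

/-- The unit interval `[0,1]` as a subtype of `ℝ`. -/
abbrev UI : Type := Set.Icc (0:ℝ) 1

/-- `C([0,1],ℝ)`, the continuous real functions on `[0,1]` with the sup-norm. -/
abbrev CC : Type := C(UI, ℝ)

instance : MeasurableSpace CC := borel CC
instance : BorelSpace CC := ⟨rfl⟩

/-- Pairing `⟨λ,h⟩ = ∫₀¹ h dλ` of a finite signed Borel measure on `[0,1]`
with a function `h`. -/
def pairSM (lam : MeasureTheory.SignedMeasure UI) (h : UI → ℝ) : ℝ :=
  (∫ t, h t ∂lam.toJordanDecomposition.posPart) -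
    (∫ t, h t ∂lam.toJordanDecomposition.negPart)

/-- Double integral `∫₀¹∫₀¹ k(t,s) dλ(t) dλ(s)`. -/
def dblInt (lam : MeasureTheory.SignedMeasure UI) (k : UI → UI → ℝ) : ℝ :=
  pairSM lam (fun t => pairSM lam (fun s => k t s))

/-- `Λ_k(λ) = (1/2)∫₀¹∫₀¹ k(t,s) dλ(t)dλ(s)`. -/
def LamK (k : UI → UI → ℝ) (lam : MeasureTheory.SignedMeasure UI) : ℝ :=
  (1/2) * dblInt lam k

/-- The Cramér transform `Λ*_k(h) = sup_λ (⟨λ,h⟩ − Λ_k(λ)) ∈ [0,∞]`. -/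
def CramerK (k : UI → UI → ℝ) (h : UI → ℝ) : ℝ≥0∞ :=
  ⨆ lam : MeasureTheory.SignedMeasure UI, ENNReal.ofReal (pairSM lam h - LamK k lam)

/-- A continuous, symmetric, positive semidefinite kernel on `[0,1]²`. -/
def IsPSDKernel (k : UI → UI → ℝ) : Prop :=
  Continuous (fun p : UI × UI => k p.1 p.2) ∧ (∀ s t, k s t = k t s) ∧
    ∀ (n : ℕ) (t : Fin n → UI) (c : Fin n → ℝ),
      0 ≤ ∑ i, ∑ j, c i * c j * k (t i) (t j)

/-- Extended logarithm of an extended nonnegative real. -/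
def elog (x : ℝ≥0∞) : EReal :=
  if x = 0 then ⊥ else if x = ⊤ then ⊤ else ((Real.log x.toReal : ℝ) : EReal)

/-- Large-deviation lower bound for open sets. -/
def LDPLower {E : Type*} [TopologicalSpace E] [MeasurableSpace E]
    (μ : ℕ → Measure E) (γ : ℕ → ℝ) (I : E → ℝ≥0∞) : Prop :=
  ∀ Θ : Set E, IsOpen Θ →
    -(⨅ x ∈ Θ, (I x : EReal)) ≤
      Filter.atTop.liminf fun n => (((γ n)⁻¹ : ℝ) : EReal) * elog (μ n Θ)

/-- Large-deviation upper bound for closed sets. -/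
def LDPUpper {E : Type*} [TopologicalSpace E] [MeasurableSpace E]
    (μ : ℕ → Measure E) (γ : ℕ → ℝ) (I : E → ℝ≥0∞) : Prop :=
  ∀ Γ : Set E, IsClosed Γ →
    (Filter.atTop.limsup fun n => (((γ n)⁻¹ : ℝ) : EReal) * elog (μ n Γ)) ≤
      -(⨅ x ∈ Γ, (I x : EReal))

/-- Large-deviation upper bound for compact sets. -/
def LDPUpperCompact {E : Type*} [TopologicalSpace E] [MeasurableSpace E]
    (μ : ℕ → Measure E) (γ : ℕ → ℝ) (I : E → ℝ≥0∞) : Prop :=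
  ∀ Γ : Set E, IsCompact Γ →
    (Filter.atTop.limsup fun n => (((γ n)⁻¹ : ℝ) : EReal) * elog (μ n Γ)) ≤
      -(⨅ x ∈ Γ, (I x : EReal))

/-- `(μₙ)` satisfies a large deviation principle with speed `γ` and
(lower semicontinuous) rate function `I`. -/
def LDP {E : Type*} [TopologicalSpace E] [MeasurableSpace E]
    (μ : ℕ → Measure E) (γ : ℕ → ℝ) (I : E → ℝ≥0∞) : Prop :=
  LowerSemicontinuous I ∧ LDPLower μ γ I ∧ LDPUpper μ γ I

/-- `(μₙ)` satisfies a weak large deviation principle with speed `γ` and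
rate function `I` (upper bound only for compact sets). -/
def WLDP {E : Type*} [TopologicalSpace E] [MeasurableSpace E]
    (μ : ℕ → Measure E) (γ : ℕ → ℝ) (I : E → ℝ≥0∞) : Prop :=
  LowerSemicontinuous I ∧ LDPLower μ γ I ∧ LDPUpperCompact μ γ I

/-- A good rate function: lower semicontinuous with compact sublevel sets. -/
def GoodRate {E : Type*} [TopologicalSpace E] (I : E → ℝ≥0∞) : Prop :=
  LowerSemicontinuous I ∧ ∀ a : ℝ≥0, IsCompact {x | I x ≤ (a : ℝ≥0∞)}

/-- A family of random variables satisfies an LDP if the family of their laws does. -/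
def LDPrv {Ω E : Type*} [MeasurableSpace Ω] [TopologicalSpace E] [MeasurableSpace E]
    (P : Measure Ω) (X : ℕ → Ω → E) (γ : ℕ → ℝ) (I : E → ℝ≥0∞) : Prop :=
  LDP (fun n => P.map (X n)) γ I

/-- A family of random variables satisfies a WLDP if the family of their laws does. -/
def WLDPrv {Ω E : Type*} [MeasurableSpace Ω] [TopologicalSpace E] [MeasurableSpace E]
    (P : Measure Ω) (X : ℕ → Ω → E) (γ : ℕ → ℝ) (I : E → ℝ≥0∞) : Prop :=
  WLDP (fun n => P.map (X n)) γ I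

/-- Exponential tightness at speed `γ(n)` of a family of `C([0,1],ℝ)`-valued
random variables. -/
def ExpTight {Ω : Type*} [MeasurableSpace Ω] (P : Measure Ω) (X : ℕ → Ω → CC)
    (γ : ℕ → ℝ) : Prop :=
  ∀ R : ℝ, 0 < R → ∃ K : Set CC, IsCompact K ∧
    (Filter.atTop.limsup fun n => (((γ n)⁻¹ : ℝ) : EReal) * elog (P (X n ⁻¹' Kᶜ))) ≤
      ((-R : ℝ) : EReal)

/-- A real random variable is Gaussian. -/
def IsGaussianRV {Ω : Type*} [MeasurableSpace Ω] (P : Measure Ω) (ξ : Ω → ℝ) : Prop :=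
  ∃ (m : ℝ) (v : ℝ≥0), P.map ξ = gaussianReal m v

/-- A `C([0,1],ℝ)`-valued random variable is a continuous Gaussian process:
`⟨λ,X⟩` is a Gaussian real random variable for every signed measure `λ`. -/
def IsContGaussian {Ω : Type*} [MeasurableSpace Ω] (P : Measure Ω) (X : Ω → CC) : Prop :=
  Measurable X ∧ ∀ lam : MeasureTheory.SignedMeasure UI,
    IsGaussianRV P fun ω => pairSM lam (X ω)

/-- A continuous Gaussian process is centered: `E⟨λ,X⟩ = 0` for all `λ`. -/
def IsCentered {Ω : Type*} [MeasurableSpace Ω] (P : Measure Ω) (X : Ω → CC) : Prop :=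
  ∀ lam : MeasureTheory.SignedMeasure UI, ∫ ω, pairSM lam (X ω) ∂P = 0

/-- `k` is the covariance function of some centered continuous Gaussian process. -/
def IsCovOfCenteredCGP (k : UI → UI → ℝ) : Prop :=
  ∃ (Ω' : Type) (_ : MeasurableSpace Ω') (P' : Measure Ω') (U : Ω' → CC),
    IsProbabilityMeasure P' ∧ IsContGaussian P' U ∧ IsCentered P' U ∧
      ∀ s t : UI, k s t = ∫ ω, U ω s * U ω t ∂P'

/-- Hypothesis (G): `(Xⁿ)` are centered continuous Gaussian processes,
exponentially tight at speed `γ(n)`, with `γ(n)·Var⟨λ,Xⁿ⟩ → ∫∫ k̄ dλdλ`,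
where `k̄` is a continuous symmetric positive semidefinite kernel which is the
covariance of some centered continuous Gaussian process. -/
def HypG {Ω : Type*} [MeasurableSpace Ω] (P : Measure Ω) (X : ℕ → Ω → CC)
    (γ : ℕ → ℝ) (kbar : UI → UI → ℝ) : Prop :=
  (∀ n, IsContGaussian P (X n)) ∧ (∀ n, IsCentered P (X n)) ∧
    ExpTight P X γ ∧ IsPSDKernel kbar ∧ IsCovOfCenteredCGP kbar ∧
    ∀ lam : MeasureTheory.SignedMeasure UI,
      Tendsto (fun n => γ n * variance (fun ω => pairSM lam (X n ω)) P) atTop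
        (nhds (dblInt lam kbar))

/-- `C_α = {y ∈ C([0,1],ℝ) : y(t) ≥ α for all t}`. -/
def Calpha (α : ℝ) : Set CC := {y : CC | ∀ t, α ≤ y t}

/-- The mean function `m(t) = e^{a₁t}(x + (a₀/a₁)(1−e^{−a₁t}))` of the
Ornstein–Uhlenbeck process. -/
def mFun (a0 a1 x : ℝ) (t : UI) : ℝ :=
  Real.exp (a1 * t) * (x + a0 / a1 * (1 - Real.exp (-(a1 * t))))

/-- The covariance kernel `kʸ(s,t) = e^{a₁(s+t)} ∫₀^{s∧t} e^{−2a₁u} y(u)² du`. -/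
def kyFun (a1 : ℝ) (y : CC) (s t : UI) : ℝ :=
  Real.exp (a1 * ((s : ℝ) + (t : ℝ))) *
    ∫ u in (0:ℝ)..(min (s : ℝ) (t : ℝ)),
      Real.exp (-(2 * a1 * u)) * (Set.IccExtend zero_le_one (⇑y) u) ^ 2

/-- The Freidlin–Wentzell rate function
`J(f|y) = (1/2)∫₀¹ ((φ(t) − a₀ − a₁f(t))/y(t))² dt` if `f = x + ∫₀^· φ` for some
`φ ∈ L²[0,1]`, and `+∞` otherwise. -/
def Jfw (a0 a1 x : ℝ) (y f : CC) : ℝ≥0∞ :=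
  ⨅ (φ : ℝ → ℝ) (_ : MemLp φ 2 (volume.restrict (Set.Icc (0:ℝ) 1)))
      (_ : ∀ t : UI, f t = x + ∫ s in (0:ℝ)..(t : ℝ), φ s),
    ENNReal.ofReal ((1/2) * ∫ t in (0:ℝ)..1,
      ((φ t - a0 - a1 * Set.IccExtend zero_le_one (⇑f) t) /
        Set.IccExtend zero_le_one (⇑y) t) ^ 2)


/-! ### The pairing is linear in the signed measure -/

lemma pairSM_of_sub (lam : SignedMeasure UI) (P N : Measure UI) [IsFiniteMeasure P]
    [IsFiniteMeasure N] (h : lam = P.toSignedMeasure - N.toSignedMeasure) (k : UI → ℝ)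
    (hk : Measurable k) (C : ℝ) (hC : ∀ t, |k t| ≤ C) :
    pairSM lam k = ∫ t, k t ∂P - ∫ t, k t ∂N := by
  have int : ∀ (Q : Measure UI) [IsFiniteMeasure Q], Integrable k Q := fun Q _ =>
    Integrable.of_bound hk.aestronglyMeasurable C (Eventually.of_forall hC)
  have e : lam.toJordanDecomposition.posPart + N = P + lam.toJordanDecomposition.negPart := by
    rw [← Measure.toSignedMeasure_eq_toSignedMeasure_iff, Measure.toSignedMeasure_add,
      Measure.toSignedMeasure_add]
    have h2 := lam.toSignedMeasure_toJordanDecomposition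
    rw [JordanDecomposition.toSignedMeasure] at h2
    exact (sub_eq_sub_iff_add_eq_add.mp (h2.trans h))
  have := congrArg (fun Q => ∫ t, k t ∂Q) e
  rw [integral_add_measure (int _) (int _), integral_add_measure (int _) (int _)] at this
  unfold pairSM
  linarith

lemma pairSM_add (l1 l2 : SignedMeasure UI) (k : UI → ℝ)
    (hk : Measurable k) (C : ℝ) (hC : ∀ t, |k t| ≤ C) :
    pairSM (l1 + l2) k = pairSM l1 k + pairSM l2 k := by
  have int : ∀ (Q : Measure UI) [IsFiniteMeasure Q], Integrable k Q := fun Q _ =>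
    Integrable.of_bound hk.aestronglyMeasurable C (Eventually.of_forall hC)
  rw [pairSM_of_sub (l1 + l2)
    (l1.toJordanDecomposition.posPart + l2.toJordanDecomposition.posPart)
    (l1.toJordanDecomposition.negPart + l2.toJordanDecomposition.negPart) _ k hk C hC]
  · rw [integral_add_measure (int _) (int _), integral_add_measure (int _) (int _)]
    unfold pairSM
    ring
  · rw [Measure.toSignedMeasure_add, Measure.toSignedMeasure_add]
    conv_lhs => rw [← l1.toSignedMeasure_toJordanDecomposition,
      ← l2.toSignedMeasure_toJordanDecomposition]
    unfold JordanDecomposition.toSignedMeasure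
    abel

lemma pairSM_neg (l : SignedMeasure UI) (k : UI → ℝ) :
    pairSM (-l) k = - pairSM l k := by
  unfold pairSM
  rw [SignedMeasure.toJordanDecomposition_neg]
  simp

lemma pairSM_smul (r : ℝ) (l : SignedMeasure UI) (k : UI → ℝ) :
    pairSM (r • l) k = r * pairSM l k := by
  have key : ∀ r : ℝ≥0, pairSM (r • l) k = r * pairSM l k := by
    intro r
    unfold pairSM
    rw [SignedMeasure.toJordanDecomposition_smul, JordanDecomposition.smul_posPart,
      JordanDecomposition.smul_negPart, integral_smul_nnreal_measure,
      integral_smul_nnreal_measure]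
    simp only [NNReal.smul_def, smul_eq_mul]
    ring
  have key2 : ∀ r : ℝ, 0 ≤ r → pairSM (r • l) k = r * pairSM l k := fun r h => key ⟨r, h⟩
  rcases le_total 0 r with h | h
  · exact key2 r h
  · have e : r • l = -((-r) • l) := by
      ext i _
      simp
    rw [e, pairSM_neg, key2 (-r) (by linarith)]
    ring

lemma pairSM_dirac (t : UI) (k : UI → ℝ)
    (hk : Measurable k) (C : ℝ) (hC : ∀ t, |k t| ≤ C) :
    pairSM (Measure.dirac t).toSignedMeasure k = k t := by
  rw [pairSM_of_sub _ (Measure.dirac t) 0 (by simp) k hk C hC]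
  simp

/-! ### Riesz representation of a functional factoring through a Hilbert space -/

lemma riesz_factor {V H : Type*} [AddCommGroup V] [Module ℝ V] [NormedAddCommGroup H]
    [InnerProductSpace ℝ H] [CompleteSpace H] (Ψ : V →ₗ[ℝ] H) (l : V →ₗ[ℝ] ℝ) (c : ℝ)
    (hc : 0 ≤ c) (h : ∀ v, |l v| ≤ c * ‖Ψ v‖) :
    ∃ θ : H, ‖θ‖ ≤ c ∧ ∀ v, l v = inner ℝ θ (Ψ v) := by
  have hker : LinearMap.ker Ψ ≤ LinearMap.ker l := by
    intro v hv
    have := h v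
    rw [LinearMap.mem_ker.mp hv] at this
    simpa using this
  let g0 : LinearMap.range Ψ →ₗ[ℝ] ℝ :=
    ((LinearMap.ker Ψ).liftQ l hker).comp (Ψ.quotKerEquivRange.symm : _ →ₗ[ℝ] _)
  have hg0 : ∀ v, g0 ⟨Ψ v, LinearMap.mem_range_self Ψ v⟩ = l v := by
    intro v
    have : Ψ.quotKerEquivRange.symm ⟨Ψ v, LinearMap.mem_range_self Ψ v⟩
        = (LinearMap.ker Ψ).mkQ v := by
      rw [LinearEquiv.symm_apply_eq]
      rfl
    simp only [g0, LinearMap.comp_apply]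
    erw [this]
    simp
  have hb : ∀ z, ‖g0 z‖ ≤ c * ‖z‖ := by
    rintro ⟨z, v, rfl⟩
    rw [hg0]
    exact h v
  obtain ⟨g, hg1, hg2⟩ := exists_extension_norm_eq (LinearMap.range Ψ)
    (g0.mkContinuous c hb)
  refine ⟨(InnerProductSpace.toDual ℝ H).symm g, ?_, ?_⟩
  · rw [LinearIsometryEquiv.norm_map, hg2]
    exact LinearMap.mkContinuous_norm_le _ hc _
  · intro v
    rw [InnerProductSpace.toDual_symm_apply, hg1 ⟨Ψ v, LinearMap.mem_range_self Ψ v⟩]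
    exact (hg0 v).symm

/-! ### Product rule for an absolutely continuous function -/

lemma prod_rule (E E' : ℝ → ℝ) (hE : ContDiff ℝ 1 E) (hE' : ∀ t, HasDerivAt E (E' t) t)
    (w : ℝ → ℝ) (T : ℝ) (hw : IntervalIntegrable w volume 0 T) :
    E T * ∫ u in (0:ℝ)..T, w u
      = ∫ t in (0:ℝ)..T, (E' t * (∫ u in (0:ℝ)..t, w u) + E t * w t) := by
  have h1 : AbsolutelyContinuousOnInterval E 0 T :=
    hE.contDiffOn.absolutelyContinuousOnInterval
  have h2 := hw.absolutelyContinuousOnInterval_intervalIntegral (c := 0) (by simp)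
  have h3 := h1.integral_deriv_mul_eq_sub h2
  simp only [intervalIntegral.integral_same, mul_zero, sub_zero] at h3
  rw [← h3]
  apply intervalIntegral.integral_congr_ae
  filter_upwards [hw.ae_hasDerivAt_integral] with t ht ht2
  rw [(hE' t).deriv, (ht (Set.uIoc_subset_uIcc ht2) 0 (by simp)).deriv]

lemma scale_bound (p q C : ℝ) (hq : 0 ≤ q) (h : ∀ r : ℝ, r * p - 1/2 * (r^2 * q) ≤ C) :
    p ^ 2 ≤ 2 * C * q := by
  rcases hq.eq_or_lt with h0 | h0
  · subst h0
    have : p = 0 := by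
      by_contra hp
      have := h ((C + 1) / p)
      rw [div_mul_cancel₀ _ hp] at this
      linarith
    simp [this]
  · have := h (p / q)
    have e : p / q * p - 1/2 * ((p/q)^2 * q) = p^2 / (2 * q) := by
      field_simp
      ring
    rw [e, div_le_iff₀ (by positivity)] at this
    linarith
/-! ### The square root of the kernel -/

/-- Lebesgue measure on `[0,1]`. -/
abbrev muI : Measure ℝ := volume.restrict (Set.Icc (0:ℝ) 1)

/-- `e^{a₁t} 1_{u ≤ t}`. -/
def Kf (a1 u : ℝ) (t : UI) : ℝ := if u ≤ (t:ℝ) then Real.exp (a1 * t) else 0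

/-- `∫ e^{a₁t} 1_{u ≤ t} dλ(t)`. -/
def Af (a1 : ℝ) (lam : SignedMeasure UI) (u : ℝ) : ℝ := pairSM lam (Kf a1 u)

/-- `e^{-a₁u} y(u)`. -/
def gf (a1 : ℝ) (y : CC) (u : ℝ) : ℝ := Real.exp (-(a1 * u)) * Set.IccExtend zero_le_one (⇑y) u

lemma Kf_meas2 (a1 : ℝ) : Measurable (fun p : UI × ℝ => Kf a1 p.2 p.1) := by
  unfold Kf
  refine Measurable.ite (measurableSet_le (by fun_prop) (by fun_prop)) (by fun_prop) (by fun_prop)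

lemma Kf_meas (a1 u : ℝ) : Measurable (Kf a1 u) :=
  (Kf_meas2 a1).comp (measurable_id.prodMk measurable_const)

lemma Kf_bound (a1 u : ℝ) (t : UI) : |Kf a1 u t| ≤ Real.exp |a1| := by
  unfold Kf
  split_ifs
  · rw [abs_of_pos (Real.exp_pos _)]
    apply Real.exp_le_exp.mpr
    have h0 := t.2.1
    have h1 := t.2.2
    calc a1 * t ≤ |a1| * t := mul_le_mul_of_nonneg_right (le_abs_self _) h0
      _ ≤ |a1| * 1 := mul_le_mul_of_nonneg_left h1 (abs_nonneg _)
      _ = |a1| := mul_one _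
  · simpa using (Real.exp_pos _).le

lemma Af_meas (a1 : ℝ) (lam : SignedMeasure UI) : Measurable (Af a1 lam) := by
  unfold Af pairSM
  have h : StronglyMeasurable (Function.uncurry fun (u : ℝ) (t : UI) => Kf a1 u t) :=
    ((Kf_meas2 a1).comp measurable_swap).stronglyMeasurable
  exact (h.integral_prod_right.measurable).sub (h.integral_prod_right.measurable)

lemma Af_bound (a1 : ℝ) (lam : SignedMeasure UI) : ∃ C, ∀ u, |Af a1 lam u| ≤ C := by
  refine ⟨Real.exp |a1| * lam.toJordanDecomposition.posPart.real Set.univ +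
    Real.exp |a1| * lam.toJordanDecomposition.negPart.real Set.univ, fun u => ?_⟩
  unfold Af pairSM
  refine (abs_sub _ _).trans (add_le_add ?_ ?_)
  · exact norm_integral_le_of_norm_le_const
      (Eventually.of_forall fun t => (Real.norm_eq_abs _).le.trans (Kf_bound a1 u t))
  · exact norm_integral_le_of_norm_le_const
      (Eventually.of_forall fun t => (Real.norm_eq_abs _).le.trans (Kf_bound a1 u t))

lemma gf_cont (a1 : ℝ) (y : CC) : Continuous (gf a1 y) := by
  unfold gf
  have : Continuous (Set.IccExtend (zero_le_one (α := ℝ)) (⇑y)) := y.continuous.Icc_extend'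
  fun_prop

lemma gf_bound (a1 : ℝ) (y : CC) : ∃ C, ∀ u ∈ Set.Icc (0:ℝ) 1, |gf a1 y u| ≤ C :=
  isCompact_Icc.exists_bound_of_continuousOn (gf_cont a1 y).continuousOn

lemma int_interval (a1 : ℝ) (w : ℝ → ℝ) (t : UI) :
    Real.exp (a1 * t) * ∫ u in (0:ℝ)..(t:ℝ), w u = ∫ u, w u * Kf a1 u t ∂muI := by
  have h1 : ∀ u, w u * Kf a1 u t
      = (Set.Iic (t:ℝ)).indicator (fun u => Real.exp (a1 * t) * w u) u := by
    intro u
    unfold Kf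
    by_cases h : u ≤ (t:ℝ) <;> simp [h, mul_comm]
  simp_rw [h1]
  rw [integral_indicator measurableSet_Iic, Measure.restrict_restrict measurableSet_Iic,
    integral_const_mul, intervalIntegral.integral_of_le t.2.1, integral_Icc_eq_integral_Ioc.symm]
  congr 3
  ext u
  have := t.2.2
  simp only [Set.mem_Icc, Set.mem_inter_iff, Set.mem_Iic]
  constructor
  · rintro ⟨h, h'⟩
    exact ⟨h', h, h'.trans this⟩
  · rintro ⟨h, h', _⟩
    exact ⟨h', h⟩

lemma pair_fubini (a1 : ℝ) (lam : SignedMeasure UI) (w : ℝ → ℝ) (hw : Integrable w muI) :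
    pairSM lam (fun t => Real.exp (a1 * t) * ∫ u in (0:ℝ)..(t:ℝ), w u)
      = ∫ u, w u * Af a1 lam u ∂muI := by
  have int : ∀ (Q : Measure UI) [IsFiniteMeasure Q],
      Integrable (Function.uncurry fun (t : UI) (u : ℝ) => w u * Kf a1 u t) (Q.prod muI) := by
    intro Q _
    refine Integrable.mul_bdd (c := Real.exp |a1|) (hw.comp_snd Q)
      (Kf_meas2 a1).aestronglyMeasurable (Eventually.of_forall fun p => Kf_bound a1 p.2 p.1)
  have key : ∀ (Q : Measure UI) [IsFiniteMeasure Q],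
      ∫ t : UI, (Real.exp (a1 * t) * ∫ u in (0:ℝ)..(t:ℝ), w u) ∂Q
        = ∫ u, w u * ∫ t, Kf a1 u t ∂Q ∂muI := by
    intro Q _
    simp_rw [int_interval a1 w]
    rw [integral_integral_swap (int Q)]
    simp_rw [integral_const_mul]
  have int2 : ∀ (Q : Measure UI) [IsFiniteMeasure Q],
      Integrable (fun u => w u * ∫ t, Kf a1 u t ∂Q) muI := by
    intro Q _
    have := (int Q).integral_prod_right
    simpa [Function.uncurry, integral_const_mul] using this
  have e : pairSM lam (fun t => Real.exp (a1 * t) * ∫ u in (0:ℝ)..(t:ℝ), w u)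
    = (∫ t : UI, (Real.exp (a1 * t) * ∫ u in (0:ℝ)..(t:ℝ), w u)
        ∂lam.toJordanDecomposition.posPart)
      - ∫ t : UI, (Real.exp (a1 * t) * ∫ u in (0:ℝ)..(t:ℝ), w u)
        ∂lam.toJordanDecomposition.negPart := rfl
  rw [e, key, key, ← integral_sub (int2 _) (int2 _)]
  refine integral_congr_ae (Eventually.of_forall fun u => ?_)
  simp only [Af, pairSM]
  ring

lemma psi_memLp (a1 : ℝ) (y : CC) (lam : SignedMeasure UI) (p : ℝ≥0∞) :
    MemLp (fun u => gf a1 y u * Af a1 lam u) p muI := by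
  obtain ⟨C, hC⟩ := gf_bound a1 y
  obtain ⟨D, hD⟩ := Af_bound a1 lam
  refine MemLp.of_bound ((gf_cont a1 y).measurable.mul (Af_meas a1 lam)).aestronglyMeasurable
    (C * D) ?_
  filter_upwards [ae_restrict_mem measurableSet_Icc] with u hu
  rw [Real.norm_eq_abs, abs_mul]
  exact mul_le_mul (hC u hu) (hD u) (abs_nonneg _) ((abs_nonneg _).trans (hC u hu))

lemma gf_memLp (a1 : ℝ) (y : CC) (p : ℝ≥0∞) : MemLp (gf a1 y) p muI := by
  obtain ⟨C, hC⟩ := gf_bound a1 y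
  refine MemLp.of_bound (gf_cont a1 y).measurable.aestronglyMeasurable C ?_
  filter_upwards [ae_restrict_mem measurableSet_Icc] with u hu using hC u hu

lemma kyFun_eq (a1 : ℝ) (y : CC) (t s : UI) :
    kyFun a1 y t s = Real.exp (a1 * s) * ∫ u in (0:ℝ)..(s:ℝ), gf a1 y u ^ 2 * Kf a1 u t := by
  rw [int_interval, kyFun]
  have := int_interval a1 (fun u => gf a1 y u ^ 2) (min t s)
  have e : Real.exp (a1 * ((t:ℝ) + s)) = Real.exp (a1 * (max t s : UI)) * Real.exp (a1 * (min t s : UI)) := by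
    rw [← Real.exp_add, ← mul_add]
    rcases le_total t s with h | h
    · rw [max_eq_right h, min_eq_left h, add_comm]
    · rw [max_eq_left h, min_eq_right h]
  have e2 : ∀ u, Real.exp (-(2 * a1 * u)) * (Set.IccExtend zero_le_one (⇑y) u) ^ 2
      = gf a1 y u ^ 2 := by
    intro u
    rw [gf, mul_pow, ← Real.exp_nat_mul]
    congr 2
    push_cast
    ring
  have e3 : min (t:ℝ) (s:ℝ) = ((min t s : UI) : ℝ) := by
    rcases le_total t s with h | h
    · rw [min_eq_left h, min_eq_left (by exact_mod_cast h)]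
    · rw [min_eq_right h, min_eq_right (by exact_mod_cast h)]
  simp_rw [e2]
  rw [e, e3, mul_assoc, this, ← integral_const_mul]
  refine integral_congr_ae (Eventually.of_forall fun u => ?_)
  simp only [Kf]
  rcases le_total t s with h | h
  · rw [max_eq_right h, min_eq_left h]
    have h' : (t:ℝ) ≤ s := h
    by_cases h1 : u ≤ t
    · simp [h1, h1.trans h']
      ring
    · simp [h1]
  · rw [max_eq_left h, min_eq_right h]
    have h' : (s:ℝ) ≤ t := h
    by_cases h1 : u ≤ s
    · simp [h1, h1.trans h']
      ring
    · simp [h1]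

lemma dblInt_eq (a1 : ℝ) (y : CC) (lam : SignedMeasure UI) :
    dblInt lam (kyFun a1 y) = ∫ u, (gf a1 y u * Af a1 lam u) ^ 2 ∂muI := by
  unfold dblInt
  have hg2 : Integrable (fun u => gf a1 y u ^ 2) muI := (gf_memLp a1 y 2).integrable_sq
  have inner1 : ∀ t : UI, pairSM lam (fun s => kyFun a1 y t s)
      = Real.exp (a1 * t) * ∫ u in (0:ℝ)..(t:ℝ), gf a1 y u ^ 2 * Af a1 lam u := by
    intro t
    simp_rw [kyFun_eq]
    rw [pair_fubini, int_interval]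
    · refine integral_congr_ae (Eventually.of_forall fun u => ?_)
      simp only
      ring
    · exact hg2.mul_bdd (c := Real.exp |a1|)
        ((Kf_meas2 a1).comp (measurable_const.prodMk measurable_id)).aestronglyMeasurable
        (Eventually.of_forall fun u => Kf_bound a1 u t)
  simp_rw [inner1]
  obtain ⟨D, hD⟩ := Af_bound a1 lam
  rw [pair_fubini]
  · refine integral_congr_ae (Eventually.of_forall fun u => ?_)
    simp only
    ring
  · exact hg2.mul_bdd (c := D) (Af_meas a1 lam).aestronglyMeasurable (Eventually.of_forall hD)

lemma Af_add (a1 : ℝ) (l1 l2 : SignedMeasure UI) (u : ℝ) :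
    Af a1 (l1 + l2) u = Af a1 l1 u + Af a1 l2 u :=
  pairSM_add l1 l2 _ (Kf_meas a1 u) _ (Kf_bound a1 u)

lemma Af_smul (a1 r : ℝ) (l : SignedMeasure UI) (u : ℝ) :
    Af a1 (r • l) u = r * Af a1 l u := pairSM_smul r l _

/-- The map `λ ↦ g A_λ` into `L²[0,1]`. -/
def PsiL (a1 : ℝ) (y : CC) : SignedMeasure UI →ₗ[ℝ] Lp ℝ 2 muI where
  toFun lam := (psi_memLp a1 y lam 2).toLp _
  map_add' l1 l2 := by
    rw [← MemLp.toLp_add]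
    congr 1
    ext u
    simp only [Pi.add_apply, Af_add]
    ring
  map_smul' r l := by
    rw [RingHom.id_apply, ← MemLp.toLp_const_smul]
    congr 1
    ext u
    simp only [Pi.smul_apply, smul_eq_mul]
    erw [Af_smul]
    ring

/-- Pairing with a continuous function, as a linear map. -/
def pairL (h : CC) : SignedMeasure UI →ₗ[ℝ] ℝ where
  toFun lam := pairSM lam h
  map_add' l1 l2 := pairSM_add l1 l2 _ h.continuous.measurable ‖h‖ (fun t => h.norm_coe_le_norm t)
  map_smul' r l := pairSM_smul r l _

lemma PsiL_norm (a1 : ℝ) (y : CC) (lam : SignedMeasure UI) :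
    dblInt lam (kyFun a1 y) = ‖PsiL a1 y lam‖ ^ 2 := by
  rw [dblInt_eq, ← real_inner_self_eq_norm_sq, L2.inner_def]
  refine integral_congr_ae ?_
  filter_upwards [(psi_memLp a1 y lam 2).coeFn_toLp] with u hu
  change _ = inner ℝ (((psi_memLp a1 y lam 2).toLp _ : ℝ → ℝ) u) (((psi_memLp a1 y lam 2).toLp _ : ℝ → ℝ) u)
  rw [hu, real_inner_self_eq_norm_sq, Real.norm_eq_abs, sq_abs]

lemma inner_PsiL (a1 : ℝ) (y : CC) (lam : SignedMeasure UI) (θ : Lp ℝ 2 muI) (θ' : ℝ → ℝ)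
    (h : θ =ᵐ[muI] θ') :
    inner ℝ θ (PsiL a1 y lam) = ∫ u, (gf a1 y u * θ' u) * Af a1 lam u ∂muI := by
  rw [L2.inner_def]
  refine integral_congr_ae ?_
  filter_upwards [(psi_memLp a1 y lam 2).coeFn_toLp, h] with u hu hu2
  change inner ℝ (θ u) (((psi_memLp a1 y lam 2).toLp _ : ℝ → ℝ) u) = _
  rw [hu, hu2]
  simp
  ring
/-! ### Cramér transform bounds -/

lemma cramer_upper (a1 : ℝ) (y : CC) (h : UI → ℝ) (θ : ℝ → ℝ) (hθ : MemLp θ 2 muI)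
    (hh : ∀ t : UI, h t = Real.exp (a1 * t) * ∫ u in (0:ℝ)..(t:ℝ), gf a1 y u * θ u) :
    CramerK (kyFun a1 y) h ≤ ENNReal.ofReal (1/2 * ‖hθ.toLp θ‖ ^ 2) := by
  refine iSup_le fun lam => ENNReal.ofReal_le_ofReal ?_
  have e : h = fun t : UI => Real.exp (a1 * t) * ∫ u in (0:ℝ)..(t:ℝ), gf a1 y u * θ u := funext hh
  have hi : Integrable (fun u => gf a1 y u * θ u) muI := (gf_memLp a1 y 2).integrable_mul hθ
  rw [LamK, PsiL_norm, e, pair_fubini a1 lam _ hi,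
    ← inner_PsiL a1 y lam (hθ.toLp θ) θ hθ.coeFn_toLp]
  have h1 := real_inner_le_norm (hθ.toLp θ) (PsiL a1 y lam)
  nlinarith [sq_nonneg (‖hθ.toLp θ‖ - ‖PsiL a1 y lam‖)]

lemma cramer_finite (a1 : ℝ) (y : CC) (h : CC) (hfin : CramerK (kyFun a1 y) h ≠ ⊤) :
    ∃ θ : Lp ℝ 2 muI, ENNReal.ofReal (1/2 * ‖θ‖ ^ 2) ≤ CramerK (kyFun a1 y) h ∧
      ∀ t : UI, h t = Real.exp (a1 * t) * ∫ u in (0:ℝ)..(t:ℝ), gf a1 y u * θ u := by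
  set C := (CramerK (kyFun a1 y) h).toReal with hC
  have hC0 : 0 ≤ C := ENNReal.toReal_nonneg
  have hb : ∀ lam : SignedMeasure UI, pairSM lam h - 1/2 * ‖PsiL a1 y lam‖ ^ 2 ≤ C := by
    intro lam
    have h1 : ENNReal.ofReal (pairSM lam h - LamK (kyFun a1 y) lam) ≤ CramerK (kyFun a1 y) h :=
      le_iSup (fun lam => ENNReal.ofReal (pairSM lam h - LamK (kyFun a1 y) lam)) lam
    rw [LamK, PsiL_norm] at h1
    exact (ENNReal.ofReal_le_iff_le_toReal hfin).mp h1
  have hsq : ∀ lam : SignedMeasure UI, pairL h lam ^ 2 ≤ 2 * C * ‖PsiL a1 y lam‖ ^ 2 := by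
    intro lam
    refine scale_bound _ _ _ (sq_nonneg _) fun r => ?_
    have h1 := hb (r • lam)
    have h2 : pairSM (r • lam) h = r * pairL h lam := pairSM_smul r lam _
    have h3 : PsiL a1 y (r • lam) = r • PsiL a1 y lam := (PsiL a1 y).map_smul r lam
    rw [h2, h3, norm_smul, mul_pow, Real.norm_eq_abs, sq_abs] at h1
    exact h1
  obtain ⟨θ, hθ1, hθ2⟩ := riesz_factor (PsiL a1 y) (pairL h) (Real.sqrt (2 * C))
    (Real.sqrt_nonneg _) (fun lam => by
      refine abs_le_of_sq_le_sq ?_ (by positivity)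
      rw [mul_pow, Real.sq_sqrt (by positivity)]
      exact hsq lam)
  refine ⟨θ, ?_, fun t => ?_⟩
  · rw [ENNReal.ofReal_le_iff_le_toReal hfin]
    have : ‖θ‖ ^ 2 ≤ Real.sqrt (2 * C) ^ 2 := pow_le_pow_left₀ (norm_nonneg _) hθ1 2
    rw [Real.sq_sqrt (by positivity)] at this
    linarith
  · have h1 := hθ2 (Measure.dirac t).toSignedMeasure
    have h2 : pairL h (Measure.dirac t).toSignedMeasure = h t :=
      pairSM_dirac t _ h.continuous.measurable ‖h‖ (fun t => h.norm_coe_le_norm t)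
    rw [h2, inner_PsiL a1 y _ θ θ (ae_eq_refl _)] at h1
    rw [h1, int_interval]
    refine integral_congr_ae (Eventually.of_forall fun u => ?_)
    simp only
    congr 1
    exact pairSM_dirac t _ (Kf_meas a1 u) _ (Kf_bound a1 u)

lemma intervalIntegrable_of_muI {w : ℝ → ℝ} (hw : Integrable w muI) (t : UI) :
    IntervalIntegrable w volume 0 t := by
  rw [intervalIntegrable_iff_integrableOn_Icc_of_le t.2.1]
  exact IntegrableOn.mono_set (t := Set.Icc (0:ℝ) 1) hw (Set.Icc_subset_Icc_right t.2.2)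

lemma ae_zero_of_primitive (w : ℝ → ℝ) (hw : Integrable w muI)
    (h : ∀ t : UI, ∫ u in (0:ℝ)..(t:ℝ), w u = 0) : w =ᵐ[muI] 0 := by
  have hw' : IntervalIntegrable w volume 0 1 := intervalIntegrable_of_muI hw ⟨1, by simp⟩
  have h1 := hw'.ae_hasDerivAt_integral
  have n0 : ∀ᵐ u : ℝ, u ≠ 0 := by simp [ae_iff, measure_singleton]
  have n1 : ∀ᵐ u : ℝ, u ≠ 1 := by simp [ae_iff, measure_singleton]
  rw [Filter.EventuallyEq, ae_restrict_iff' measurableSet_Icc]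
  filter_upwards [h1, n0, n1] with u hu h0 h1 hm
  have hd := hu (by rwa [Set.uIcc_of_le zero_le_one]) 0 (by simp)
  have hev : (fun x => ∫ t in (0:ℝ)..x, w t) =ᶠ[𝓝 u] fun _ => 0 := by
    filter_upwards [Icc_mem_nhds (lt_of_le_of_ne hm.1 h0.symm) (lt_of_le_of_ne hm.2 h1)]
      with v hv using h ⟨v, hv⟩
  exact hd.unique ((hasDerivAt_const u (0:ℝ)).congr_of_eventuallyEq hev)

lemma ext_cont (f : CC) : Continuous (Set.IccExtend (zero_le_one (α := ℝ)) (⇑f)) :=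
  f.continuous.Icc_extend'

lemma cont_memLp {F : ℝ → ℝ} (hF : Continuous F) (p : ℝ≥0∞) : MemLp F p muI := by
  obtain ⟨C, hC⟩ := (isCompact_Icc (a := (0:ℝ)) (b := 1)).exists_bound_of_continuousOn
    hF.continuousOn
  refine MemLp.of_bound hF.measurable.aestronglyMeasurable C ?_
  filter_upwards [ae_restrict_mem measurableSet_Icc] with u hu using hC u hu

lemma bdd_mul_memLp {F w : ℝ → ℝ} (hF : Continuous F) (hw : MemLp w 2 muI) :
    MemLp (fun u => F u * w u) 2 muI :=
  hw.mul' (cont_memLp hF ⊤)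

lemma uIcc_sub (t : UI) {s : ℝ} (hs : s ∈ Set.uIcc (0:ℝ) t) : s ∈ Set.Icc (0:ℝ) 1 := by
  rw [Set.uIcc_of_le t.2.1] at hs
  exact ⟨hs.1, hs.2.trans t.2.2⟩

lemma decomp_fwd (a0 a1 x : ℝ) (ha1 : a1 ≠ 0) (y : CC) (hy : ∀ t, 0 < y t) (f : CC)
    (φ : ℝ → ℝ) (hφ : MemLp φ 2 muI)
    (hf : ∀ t : UI, f t = x + ∫ s in (0:ℝ)..(t : ℝ), φ s) (t : UI) :
    f t - mFun a0 a1 x t = Real.exp (a1 * t) * ∫ u in (0:ℝ)..(t:ℝ),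
      gf a1 y u * ((φ u - a0 - a1 * Set.IccExtend zero_le_one (⇑f) u) /
            Set.IccExtend zero_le_one (⇑y) u) := by
  have hφ1 : Integrable φ muI := hφ.integrable (by norm_num)
  have hφt := intervalIntegrable_of_muI hφ1 t
  have hfc := ext_cont f
  have pr := prod_rule (fun s => Real.exp (-(a1 * s))) (fun s => -a1 * Real.exp (-(a1 * s)))
    (by fun_prop) (fun s => by
      have := (((hasDerivAt_id s).const_mul a1).neg).exp
      refine this.congr_deriv ?_
      simp
      ring) φ t hφt
  have e1 : ∫ s in (0:ℝ)..(t:ℝ), (-a1 * Real.exp (-(a1 * s)) * (∫ u in (0:ℝ)..s, φ u)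
      + Real.exp (-(a1 * s)) * φ s)
      = ∫ s in (0:ℝ)..(t:ℝ), (Real.exp (-(a1 * s)) *
        (φ s - a0 - a1 * Set.IccExtend zero_le_one (⇑f) s) +
          (a0 + a1 * x) * Real.exp (-(a1 * s))) := by
    refine intervalIntegral.integral_congr fun s hs => ?_
    have hs' := uIcc_sub t hs
    have := hf ⟨s, hs'⟩
    rw [Set.IccExtend_of_mem _ _ hs', this]
    ring
  have e2 : ∫ s in (0:ℝ)..(t:ℝ), Real.exp (-(a1 * s)) = (1 - Real.exp (-(a1 * t))) / a1 := by
    rw [intervalIntegral.integral_eq_sub_of_hasDerivAt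
      (f := fun s => - Real.exp (-(a1 * s)) / a1)]
    · simp
      ring
    · intro s _
      have := ((((hasDerivAt_id s).const_mul a1).neg).exp.neg).div_const a1
      refine this.congr_deriv ?_
      simp
      field_simp
    · exact (by fun_prop : Continuous fun s => Real.exp (-(a1 * s))).intervalIntegrable _ _
  have e3 : ∫ u in (0:ℝ)..(t:ℝ),
      gf a1 y u * ((φ u - a0 - a1 * Set.IccExtend zero_le_one (⇑f) u) /
            Set.IccExtend zero_le_one (⇑y) u)
      = ∫ s in (0:ℝ)..(t:ℝ), Real.exp (-(a1 * s)) *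
        (φ s - a0 - a1 * Set.IccExtend zero_le_one (⇑f) s) := by
    refine intervalIntegral.integral_congr fun s hs => ?_
    have hs' := uIcc_sub t hs
    have := (hy ⟨s, hs'⟩).ne'
    simp only [gf]
    rw [Set.IccExtend_of_mem _ (⇑y) hs']
    field_simp
  have i1 : IntervalIntegrable (fun s => Real.exp (-(a1 * s)) *
        (φ s - a0 - a1 * Set.IccExtend zero_le_one (⇑f) s)) volume 0 t := by
    refine IntervalIntegrable.continuousOn_mul ?_ (by fun_prop)
    exact (hφt.sub intervalIntegrable_const).sub
      ((continuous_const.mul hfc).intervalIntegrable _ _)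
  have i2 : IntervalIntegrable (fun s => (a0 + a1 * x) * Real.exp (-(a1 * s))) volume 0 t :=
    Continuous.intervalIntegrable (by fun_prop) _ _
  rw [e1, intervalIntegral.integral_add i1 i2, intervalIntegral.integral_const_mul, e2, ← e3,
    eq_sub_of_add_eq' (hf t).symm] at pr
  have e4 : Real.exp (a1 * t) * Real.exp (-(a1 * t)) = 1 := by
    rw [← Real.exp_add]
    simp
  rw [← sub_eq_iff_eq_add] at pr
  rw [← pr, mFun]
  generalize Real.exp (a1 * t) = E at *
  generalize Real.exp (-(a1 * t)) = E' at *
  field_simp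
  linear_combination (-(a1 * f t)) * e4

lemma mFun_eq (a0 a1 x : ℝ) (ha1 : a1 ≠ 0) (t : UI) :
    mFun a0 a1 x t = x + ∫ s in (0:ℝ)..(t:ℝ), (a0 + a1 *
      (Real.exp (a1 * s) * (x + a0 / a1 * (1 - Real.exp (-(a1 * s)))))) := by
  rw [intervalIntegral.integral_eq_sub_of_hasDerivAt
    (f := fun s => Real.exp (a1 * s) * (x + a0 / a1 * (1 - Real.exp (-(a1 * s)))))]
  · simp [mFun]
  · intro s _
    have h1 := ((hasDerivAt_id s).const_mul a1).exp
    have h2 := ((hasDerivAt_id s).const_mul a1).neg.exp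
    have h3 := h1.mul (((h2.const_sub 1).const_mul (a0 / a1)).const_add x)
    refine h3.congr_deriv ?_
    have e4 : Real.exp (a1 * s) * Real.exp (-(a1 * s)) = 1 := by
      rw [← Real.exp_add]
      simp
    simp
    field_simp
    linear_combination a0 * e4
  · exact Continuous.intervalIntegrable (by fun_prop) _ _

lemma decomp_bwd (a0 a1 x : ℝ) (ha1 : a1 ≠ 0) (y : CC) (f : CC)
    (θ : ℝ → ℝ) (hθ : MemLp θ 2 muI)
    (hf : ∀ t : UI, f t - mFun a0 a1 x t = Real.exp (a1 * t) *
      ∫ u in (0:ℝ)..(t:ℝ), gf a1 y u * θ u) :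
    ∃ φ : ℝ → ℝ, MemLp φ 2 muI ∧ ∀ t : UI, f t = x + ∫ s in (0:ℝ)..(t : ℝ), φ s := by
  have hfc := ext_cont f
  have hyc := ext_cont y
  have hy2 := bdd_mul_memLp hyc hθ
  refine ⟨fun u => Set.IccExtend zero_le_one (⇑y) u * θ u
    + (a0 + a1 * Set.IccExtend zero_le_one (⇑f) u), ?_, ?_⟩
  · exact hy2.add (cont_memLp (by fun_prop) 2)
  · intro t
    have hi : Integrable (fun u => gf a1 y u * θ u) muI := (gf_memLp a1 y 2).integrable_mul hθ
    have pr := prod_rule (fun s => Real.exp (a1 * s)) (fun s => a1 * Real.exp (a1 * s))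
      (by fun_prop) (fun s => by
        have := (((hasDerivAt_id s).const_mul a1)).exp
        refine this.congr_deriv ?_
        simp
        ring) _ t (intervalIntegrable_of_muI hi t)
    have e : ∫ s in (0:ℝ)..(t:ℝ), (a1 * Real.exp (a1 * s) * (∫ u in (0:ℝ)..s, gf a1 y u * θ u)
        + Real.exp (a1 * s) * (gf a1 y s * θ s))
        = ∫ s in (0:ℝ)..(t:ℝ), ((Set.IccExtend zero_le_one (⇑y) s * θ s
          + (a0 + a1 * Set.IccExtend zero_le_one (⇑f) s)) - (a0 + a1 *
            (Real.exp (a1 * s) * (x + a0 / a1 * (1 - Real.exp (-(a1 * s))))))) := by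
      refine intervalIntegral.integral_congr fun s hs => ?_
      have hs' := uIcc_sub t hs
      have := hf ⟨s, hs'⟩
      have e4 : Real.exp (a1 * s) * Real.exp (-(a1 * s)) = 1 := by
        rw [← Real.exp_add]
        simp
      simp only [gf, mFun] at this ⊢
      rw [Set.IccExtend_of_mem _ (⇑f) hs']
      linear_combination (-a1) * this + (Set.IccExtend zero_le_one (⇑y) s * θ s) * e4
    have i1 : IntervalIntegrable (fun s => Set.IccExtend zero_le_one (⇑y) s * θ s
          + (a0 + a1 * Set.IccExtend zero_le_one (⇑f) s)) volume 0 t :=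
      (intervalIntegrable_of_muI (hy2.integrable (by norm_num)) t).add
        (Continuous.intervalIntegrable (by fun_prop) _ _)
    rw [e, intervalIntegral.integral_sub i1 (Continuous.intervalIntegrable (by fun_prop) _ _),
      ← hf t] at pr
    have := mFun_eq a0 a1 x ha1 t
    linarith
lemma mFun_cont (a0 a1 x : ℝ) : Continuous (mFun a0 a1 x) := by
  unfold mFun
  fun_prop

/-- the Gaussian rate function `Λ*_{kʸ}(f−m)` coincides with the
Freidlin–Wentzell rate function `J(f|y)`. -/
theorem statement11 (α : ℝ) (hα : 0 < α) (a0 a1 x : ℝ) (ha1 : a1 ≠ 0)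
    (y : CC) (hy : y ∈ Calpha α) (f : CC) :
    (∀ φ : ℝ → ℝ, MemLp φ 2 (volume.restrict (Set.Icc (0:ℝ) 1)) →
      (∀ t : UI, f t = x + ∫ s in (0:ℝ)..(t : ℝ), φ s) →
      CramerK (kyFun a1 y) (fun t => f t - mFun a0 a1 x t) =
        ENNReal.ofReal ((1/2) * ∫ t in (0:ℝ)..1,
          ((φ t - a0 - a1 * Set.IccExtend zero_le_one (⇑f) t) /
            Set.IccExtend zero_le_one (⇑y) t) ^ 2)) ∧
      ((¬ ∃ φ : ℝ → ℝ, MemLp φ 2 (volume.restrict (Set.Icc (0:ℝ) 1)) ∧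
          ∀ t : UI, f t = x + ∫ s in (0:ℝ)..(t : ℝ), φ s) →
        CramerK (kyFun a1 y) (fun t => f t - mFun a0 a1 x t) = ⊤) := by
  have hy0 : ∀ t, 0 < y t := fun t => lt_of_lt_of_le hα (hy t)
  let h : CC := ⟨fun t => f t - mFun a0 a1 x t, f.continuous.sub (mFun_cont a0 a1 x)⟩
  constructor
  · intro φ hφ hf
    have hd := decomp_fwd a0 a1 x ha1 y hy0 f φ hφ hf
    set θ : ℝ → ℝ := fun u => (φ u - a0 - a1 * Set.IccExtend zero_le_one (⇑f) u) /
            Set.IccExtend zero_le_one (⇑y) u with hθdef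
    have hfc := ext_cont f
    have hθ : MemLp θ 2 muI := by
      have hn : MemLp (fun u => φ u - a0 - a1 * Set.IccExtend zero_le_one (⇑f) u) 2 muI :=
        (hφ.sub (cont_memLp continuous_const 2)).sub (cont_memLp (by fun_prop) 2)
      have hyi : Continuous fun u => (Set.IccExtend (zero_le_one (α := ℝ)) (⇑y) u)⁻¹ :=
        (ext_cont y).inv₀ fun u => (hy0 _).ne'
      have := bdd_mul_memLp hyi hn
      simpa only [hθdef, div_eq_mul_inv, mul_comm] using this
    have up := cramer_upper a1 y (fun t => f t - mFun a0 a1 x t) θ hθ hd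
    have hint : ∫ t in (0:ℝ)..1, θ t ^ 2 = ‖hθ.toLp θ‖ ^ 2 := by
      rw [← real_inner_self_eq_norm_sq, L2.inner_def, intervalIntegral.integral_of_le zero_le_one,
        ← integral_Icc_eq_integral_Ioc]
      refine integral_congr_ae ?_
      filter_upwards [hθ.coeFn_toLp] with u hu
      rw [hu, real_inner_self_eq_norm_sq, Real.norm_eq_abs, sq_abs]
    change _ = ENNReal.ofReal (1/2 * ∫ t in (0:ℝ)..1, θ t ^ 2)
    rw [hint]
    refine le_antisymm up ?_
    obtain ⟨θ', h1, h2⟩ := cramer_finite a1 y h (ne_top_of_le_ne_top ENNReal.ofReal_ne_top up)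
    have hi : Integrable (fun u => gf a1 y u * θ u) muI := (gf_memLp a1 y 2).integrable_mul hθ
    have hi' : Integrable (fun u => gf a1 y u * θ' u) muI :=
      (gf_memLp a1 y 2).integrable_mul (Lp.memLp θ')
    have hz := ae_zero_of_primitive _ (hi.sub hi') (fun t => by
      simp only [Pi.sub_apply]
      rw [intervalIntegral.integral_sub (intervalIntegrable_of_muI hi t)
        (intervalIntegrable_of_muI hi' t), sub_eq_zero]
      exact mul_left_cancel₀ (Real.exp_pos (a1 * t)).ne' ((hd t).symm.trans (h2 t)))
    have heq : hθ.toLp θ = θ' := by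
      refine Lp.ext ?_
      filter_upwards [hθ.coeFn_toLp, hz] with u hu hu2
      rw [hu]
      have hg : gf a1 y u ≠ 0 := mul_ne_zero (Real.exp_pos _).ne' (hy0 _).ne'
      simp only [Pi.sub_apply, Pi.zero_apply, sub_eq_zero] at hu2
      exact mul_left_cancel₀ hg hu2
    rw [heq]
    exact h1
  · intro hne
    by_contra hfin
    obtain ⟨θ', -, h2⟩ := cramer_finite a1 y h hfin
    exact hne (decomp_bwd a0 a1 x ha1 y f θ' (Lp.memLp θ') h2)

end
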